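/- Let T ∈ ℂ^{2n×2n} be an invertible doubled-up matrix and set Ξ := Φ_n T J_n T† Φ_n†, where Φ_n := [[I_n, I_n],[−iI_n, iI_n]]. Then Ξ is purely imaginary (Ξ^# = −Ξ), and consequently Θ̃ := −(i/2)Ξ is a real, skew-symmetric (Θ̃^T = −Θ̃), invertible matrix. -/

import Mathlib

open Matrix

noncomputable section

/-- `J_k = [[I, 0],[0, −I]]`. -/
def Jmat (k : ℕ) : Matrix (Fin k ⊕ Fin k) (Fin k ⊕ Fin k) ℂ :=
  Matrix.fromBlocks 1 0 0 (-1)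

/-- `Σ_k = [[0, I],[I, 0]]`. -/
def SigmaMat (k : ℕ) : Matrix (Fin k ⊕ Fin k) (Fin k ⊕ Fin k) ℂ :=
  Matrix.fromBlocks 0 1 1 0

/-- `J̃_k = [[0, I],[−I, 0]]`, regarded as a complex matrix. -/
def JtC (k : ℕ) : Matrix (Fin k ⊕ Fin k) (Fin k ⊕ Fin k) ℂ :=
  Matrix.fromBlocks 0 1 (-1) 0

/-- `Φ_k = [[I, I],[−iI, iI]]`. -/
def Phi (k : ℕ) : Matrix (Fin k ⊕ Fin k) (Fin k ⊕ Fin k) ℂ :=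
  Matrix.fromBlocks 1 1 (-(Complex.I • 1)) (Complex.I • 1)

/-- Entrywise complex conjugate of a matrix. -/
def conjMat {α β : Type*} (R : Matrix α β ℂ) : Matrix α β ℂ :=
  R.map (starRingEnd ℂ)

/-- `R ∈ ℂ^{2n×2m}` is doubled-up if `R Σ_m = Σ_n R^#`. -/
def DoubledUp {n m : ℕ} (R : Matrix (Fin n ⊕ Fin n) (Fin m ⊕ Fin m) ℂ) : Prop :=
  R * SigmaMat m = SigmaMat n * conjMat R

/-- A complex matrix has real entries if every entry has zero imaginary part. -/
def HasRealEntries {α β : Type*} (R : Matrix α β ℂ) : Prop :=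
  ∀ i j, (R i j).im = 0

theorem SigmaMat_mul_self (k : ℕ) : SigmaMat k * SigmaMat k = 1 := by
  simp [SigmaMat, fromBlocks_multiply]

theorem SigmaMat_conjTranspose (k : ℕ) : (SigmaMat k)ᴴ = SigmaMat k := by
  simp [SigmaMat, fromBlocks_conjTranspose]

theorem Jmat_conjTranspose (k : ℕ) : (Jmat k)ᴴ = Jmat k := by
  simp [Jmat, fromBlocks_conjTranspose]

theorem Jmat_mul_self (k : ℕ) : Jmat k * Jmat k = 1 := by
  simp [Jmat, fromBlocks_multiply]

theorem SigmaMat_mul_Jmat_mul_SigmaMat (k : ℕ) :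
    SigmaMat k * Jmat k * SigmaMat k = -Jmat k := by
  simp [SigmaMat, Jmat, fromBlocks_multiply, fromBlocks_neg]

theorem conjMat_mul {α β γ : Type*} [Fintype β] (A : Matrix α β ℂ) (B : Matrix β γ ℂ) :
    conjMat (A * B) = conjMat A * conjMat B :=
  Matrix.map_mul

theorem conjMat_conjTranspose {α β : Type*} (A : Matrix α β ℂ) :
    conjMat Aᴴ = (conjMat A)ᴴ :=
  rfl

theorem conjMat_Jmat (k : ℕ) : conjMat (Jmat k) = Jmat k := by
  change ((Jmat k)ᵀ)ᴴ = _
  simp [Jmat, fromBlocks_conjTranspose, fromBlocks_transpose]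

theorem conjMat_Phi (k : ℕ) : conjMat (Phi k) = Phi k * SigmaMat k := by
  change ((Phi k)ᵀ)ᴴ = _
  simp [Phi, SigmaMat, fromBlocks_conjTranspose, fromBlocks_transpose, fromBlocks_multiply]

theorem isUnit_Phi (k : ℕ) : IsUnit (Phi k) := by
  have h : Phi k * ((1 / 2 : ℂ) • (Phi k)ᴴ) = 1 := by
    simp [Phi, fromBlocks_conjTranspose, fromBlocks_multiply, fromBlocks_smul, smul_smul,
      ← add_smul, mul_assoc, -one_div]
  exact IsUnit.of_mul_eq_one _ h

theorem DoubledUp.conjMat_eq {n m : ℕ} {R : Matrix (Fin n ⊕ Fin n) (Fin m ⊕ Fin m) ℂ}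
    (h : DoubledUp R) : conjMat R = SigmaMat n * R * SigmaMat m := by
  rw [Matrix.mul_assoc, show R * SigmaMat m = SigmaMat n * conjMat R from h, ← Matrix.mul_assoc,
    SigmaMat_mul_self, Matrix.one_mul]

/-- A congruence of `J_k` by a matrix `S` with `S^# = S Σ_k` is purely imaginary. -/
theorem conjMat_mul_Jmat_mul_conjTranspose {α : Type*} {k : ℕ}
    {S : Matrix α (Fin k ⊕ Fin k) ℂ} (hS : conjMat S = S * SigmaMat k) :
    conjMat (S * Jmat k * Sᴴ) = -(S * Jmat k * Sᴴ) := by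
  have h : conjMat (S * Jmat k * Sᴴ) = S * (SigmaMat k * Jmat k * SigmaMat k) * Sᴴ := by
    simp only [conjMat_mul, conjMat_conjTranspose, conjMat_Jmat, hS, conjTranspose_mul,
      SigmaMat_conjTranspose, Matrix.mul_assoc]
  rw [h, SigmaMat_mul_Jmat_mul_SigmaMat, Matrix.mul_neg, Matrix.neg_mul]

theorem isHermitian_mul_Jmat_mul_conjTranspose {α : Type*} {k : ℕ}
    (S : Matrix α (Fin k ⊕ Fin k) ℂ) : (S * Jmat k * Sᴴ).IsHermitian :=
  isHermitian_mul_mul_conjTranspose S (Jmat_conjTranspose k)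

theorem transpose_eq_neg_of_conjMat_eq_neg {α : Type*} {M : Matrix α α ℂ}
    (hM : M.IsHermitian) (h : conjMat M = -M) : Mᵀ = -M := by
  rw [← h]
  nth_rewrite 2 [← hM.eq]
  ext i j
  simp [conjMat]

theorem hasRealEntries_smul_of_conjMat_eq_neg {α β : Type*} {M : Matrix α β ℂ}
    (h : conjMat M = -M) : HasRealEntries ((-(Complex.I / 2)) • M) := by
  intro i j
  have hij : (starRingEnd ℂ) (M i j) = -M i j := congr_fun₂ h i j
  have hre : (M i j).re = -(M i j).re := by simpa using congr_arg Complex.re hij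
  have h0 : (M i j).re = 0 := by linarith
  simp [h0]

/-- for an invertible doubled-up `T`, the matrix `Ξ := Φ_n T J_n T† Φ_n†` is
purely imaginary, and `Θ̃ := −(i/2)Ξ` is real, skew-symmetric and invertible. -/
theorem stmt14 (n : ℕ) (hn : 0 < n)
    (T : Matrix (Fin n ⊕ Fin n) (Fin n ⊕ Fin n) ℂ)
    (hT : IsUnit T) (hTd : DoubledUp T) :
    conjMat (Phi n * (T * Jmat n * Tᴴ) * (Phi n)ᴴ) =
        -(Phi n * (T * Jmat n * Tᴴ) * (Phi n)ᴴ) ∧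
      HasRealEntries ((-(Complex.I / 2)) • (Phi n * (T * Jmat n * Tᴴ) * (Phi n)ᴴ)) ∧
      ((-(Complex.I / 2)) • (Phi n * (T * Jmat n * Tᴴ) * (Phi n)ᴴ))ᵀ =
        -((-(Complex.I / 2)) • (Phi n * (T * Jmat n * Tᴴ) * (Phi n)ᴴ)) ∧
      IsUnit ((-(Complex.I / 2)) • (Phi n * (T * Jmat n * Tᴴ) * (Phi n)ᴴ)) := by
  set S := Phi n * T with hSdef
  have hM : Phi n * (T * Jmat n * Tᴴ) * (Phi n)ᴴ = S * Jmat n * Sᴴ := by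
    simp only [hSdef, conjTranspose_mul, Matrix.mul_assoc]
  have hS : conjMat S = S * SigmaMat n := by
    rw [hSdef, conjMat_mul, conjMat_Phi, hTd.conjMat_eq]
    simp only [Matrix.mul_assoc]
    rw [← Matrix.mul_assoc (SigmaMat n) (SigmaMat n), SigmaMat_mul_self, Matrix.one_mul]
  have hSu : IsUnit S := (isUnit_Phi n).mul hT
  rw [hM]
  have hconj := conjMat_mul_Jmat_mul_conjTranspose hS
  refine ⟨hconj, hasRealEntries_smul_of_conjMat_eq_neg hconj, ?_, ?_⟩
  · rw [transpose_smul, transpose_eq_neg_of_conjMat_eq_neg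
      (isHermitian_mul_Jmat_mul_conjTranspose S) hconj, smul_neg]
  · have hc : -(Complex.I / 2) ≠ 0 := by simp
    have hJ : IsUnit (Jmat n) := IsUnit.of_mul_eq_one _ (Jmat_mul_self n)
    exact ((hSu.mul hJ).mul hSu.star).smul (Units.mk0 _ hc)
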